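/- For every fixed ρ < 0, S̈ = Σ_{j=1}^k W̃_j² (S₁ - C_j)² converges to 0 as k → ∞. (Lemma 1(iv)) -/

import Mathlib

open Filter Finset MeasureTheory ProbabilityTheory

/-- The weights `W_j = 1 - j/(k+1)`. -/
noncomputable def Wk (k j : ℕ) : ℝ := 1 - (j : ℝ) / ((k : ℝ) + 1)

/-- The normalized weights `W̃_j = W_j / ∑_{i=1}^k W_i`. -/
noncomputable def Wt (k j : ℕ) : ℝ := Wk k j / ∑ i ∈ Finset.Icc 1 k, Wk k i

/-- The covariates `C_j = (j/(k+1))^{-ρ}`. -/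
noncomputable def Cjk (ρ : ℝ) (k j : ℕ) : ℝ := ((j : ℝ) / ((k : ℝ) + 1)) ^ (-ρ)

/-- `S₁ = ∑_{j=1}^k W̃_j C_j`. -/
noncomputable def Sone (ρ : ℝ) (k : ℕ) : ℝ := ∑ j ∈ Finset.Icc 1 k, Wt k j * Cjk ρ k j

/-- `S₂ = ∑_{j=1}^k W̃_j C_j² - (∑_{j=1}^k W̃_j C_j)²`. -/
noncomputable def Stwo (ρ : ℝ) (k : ℕ) : ℝ :=
  (∑ j ∈ Finset.Icc 1 k, Wt k j * (Cjk ρ k j) ^ 2) - (Sone ρ k) ^ 2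

theorem sum_Wk (k : ℕ) : ∑ i ∈ Finset.Icc 1 k, Wk k i = (k : ℝ) / 2 := by
  have sum_cast (n : ℕ) : ∑ i ∈ Finset.Icc 1 n, (i : ℝ) = (n : ℝ) * (n + 1) / 2 := by
    induction n with
    | zero => simp
    | succ n ih =>
      rw [Finset.sum_Icc_succ_top (by omega), ih]
      push_cast
      ring
  have hk : (k : ℝ) + 1 ≠ 0 := by positivity
  simp only [Wk, Finset.sum_sub_distrib, ← Finset.sum_div, sum_cast]
  simp only [Finset.sum_const, Nat.card_Icc, add_tsub_cancel_right, nsmul_eq_mul, mul_one]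
  field_simp
  ring

theorem Wk_mem_Icc {k j : ℕ} (hj : j ≤ k) : Wk k j ∈ Set.Icc (0 : ℝ) 1 := by
  have hjk : (j : ℝ) ≤ k := by exact_mod_cast hj
  have h : (j : ℝ) / ((k : ℝ) + 1) ≤ 1 := (div_le_one (by positivity)).2 (by linarith)
  have h' : 0 ≤ (j : ℝ) / ((k : ℝ) + 1) := by positivity
  constructor <;> unfold Wk <;> linarith

theorem Wt_nonneg {k j : ℕ} (hj : j ≤ k) : 0 ≤ Wt k j := by
  rw [Wt, sum_Wk]
  exact div_nonneg (Wk_mem_Icc hj).1 (by positivity)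

theorem Wt_le {k j : ℕ} (hj : j ≤ k) : Wt k j ≤ 2 / k := by
  rw [Wt, sum_Wk, div_div_eq_mul_div]
  gcongr
  linarith [(Wk_mem_Icc hj).2]

theorem sum_Wt {k : ℕ} (hk : k ≠ 0) : ∑ j ∈ Finset.Icc 1 k, Wt k j = 1 := by
  simp only [Wt, ← Finset.sum_div]
  refine div_self ?_
  rw [sum_Wk]
  positivity

theorem Cjk_mem_Icc {ρ : ℝ} (hρ : ρ ≤ 0) {k j : ℕ} (hj : j ≤ k) :
    Cjk ρ k j ∈ Set.Icc (0 : ℝ) 1 := by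
  have hjk : (j : ℝ) ≤ k := by exact_mod_cast hj
  have h : (j : ℝ) / ((k : ℝ) + 1) ≤ 1 := (div_le_one (by positivity)).2 (by linarith)
  have h' : 0 ≤ (j : ℝ) / ((k : ℝ) + 1) := by positivity
  exact ⟨Real.rpow_nonneg h' _, Real.rpow_le_one h' h (by linarith)⟩

theorem Sone_mem_Icc {ρ : ℝ} (hρ : ρ ≤ 0) {k : ℕ} (hk : k ≠ 0) :
    Sone ρ k ∈ Set.Icc (0 : ℝ) 1 := by
  refine ⟨Finset.sum_nonneg fun j hj => ?_, ?_⟩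
  · have hj := (Finset.mem_Icc.1 hj).2
    exact mul_nonneg (Wt_nonneg hj) (Cjk_mem_Icc hρ hj).1
  · rw [← sum_Wt hk]
    refine Finset.sum_le_sum fun j hj => ?_
    have hj := (Finset.mem_Icc.1 hj).2
    exact mul_le_of_le_one_right (Wt_nonneg hj) (Cjk_mem_Icc hρ hj).2

/-- Lemma 1(iv): For every fixed ρ < 0,
`S̈ = ∑_{j=1}^k W̃_j² (S₁ - C_j)² → 0` as `k → ∞`. -/
theorem Sddot_tendsto (ρ : ℝ) (hρ : ρ < 0) :
    Filter.Tendsto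
      (fun k : ℕ => ∑ j ∈ Finset.Icc 1 k, (Wt k j) ^ 2 * (Sone ρ k - Cjk ρ k j) ^ 2)
      Filter.atTop (nhds 0) := by
  refine squeeze_zero' (.of_forall fun k => by positivity) ?_
    (tendsto_const_div_atTop_nhds_zero_nat 4)
  filter_upwards [eventually_ne_atTop 0] with k hk
  have hk' : (k : ℝ) ≠ 0 := by exact_mod_cast hk
  calc ∑ j ∈ Finset.Icc 1 k, (Wt k j) ^ 2 * (Sone ρ k - Cjk ρ k j) ^ 2
      ≤ ∑ _j ∈ Finset.Icc 1 k, (2 / (k : ℝ)) ^ 2 * 1 := by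
        refine Finset.sum_le_sum fun j hj => ?_
        have hj := (Finset.mem_Icc.1 hj).2
        obtain ⟨hS, hS'⟩ := Sone_mem_Icc hρ.le hk
        obtain ⟨hC, hC'⟩ := Cjk_mem_Icc hρ.le hj
        refine mul_le_mul (pow_le_pow_left₀ (Wt_nonneg hj) (Wt_le hj) 2) ?_
          (by positivity) (by positivity)
        rw [sq_le_one_iff_abs_le_one, abs_le]
        constructor <;> linarith
    _ = 4 / (k : ℝ) := by
        simp only [Finset.sum_const, Nat.card_Icc, add_tsub_cancel_right, nsmul_eq_mul]
        field_simp
        norm_num
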